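/- For any δ > 0, any Borel probability measure P on ℝ^d, and any α ∈ (0,1), the exact level set {z ∈ ℝ^d : D_δ(z|P) = α} equals the topological boundary of the upper level set {z ∈ ℝ^d : D_δ(z|P) ≥ α}, or both sets are empty. -/

import Mathlib

open MeasureTheory RealInnerProductSpace
open scoped ENNReal

abbrev Ed (d : ℕ) := EuclideanSpace ℝ (Fin d)

/-- 1-Wasserstein distance between Borel measures on `ℝ^d`. -/
noncomputable def wassersteinDist {d : ℕ} (P Q : Measure (Ed d)) : ℝ≥0∞ :=
  ⨅ (π : Measure (Ed d × Ed d)) (_ : π.map Prod.fst = P) (_ : π.map Prod.snd = Q),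
    ∫⁻ p, ENNReal.ofReal ‖p.1 - p.2‖ ∂π

/-- Worst-case probability of a set over the Wasserstein ball of radius `δ` around `P`. -/
noncomputable def supProb {d : ℕ} (δ : ℝ) (P : Measure (Ed d)) (A : Set (Ed d)) : ℝ :=
  sSup {v : ℝ | ∃ Q : Measure (Ed d), IsProbabilityMeasure Q ∧
    wassersteinDist Q P ≤ ENNReal.ofReal δ ∧ v = (Q A).toReal}

/-- Distributionally robust halfspace depth. -/
noncomputable def robustDepth {d : ℕ} (δ : ℝ) (z : Ed d) (P : Measure (Ed d)) : ℝ :=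
  sInf {v : ℝ | ∃ u : Ed d, ‖u‖ = 1 ∧ v = supProb δ P {x | 0 ≤ ⟪u, x - z⟫}}

/-- The cost of transporting the mass of `ν` to the halfspace `{x | 0 ≤ ⟪u, x - z⟫}`, for a
unit vector `u`. -/
noncomputable def halfspaceCost {d : ℕ} (u z : Ed d) (ν : Measure (Ed d)) : ℝ≥0∞ :=
  ∫⁻ x, ENNReal.ofReal ⟪u, z - x⟫ ∂ν

section

variable {d : ℕ} {δ : ℝ} {P : Measure (Ed d)} {u z : Ed d}

lemma wassersteinDist_le {Q : Measure (Ed d)} {π : Measure (Ed d × Ed d)}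
    (h₁ : π.map Prod.fst = Q) (h₂ : π.map Prod.snd = P) :
    wassersteinDist Q P ≤ ∫⁻ p, ENNReal.ofReal ‖p.1 - p.2‖ ∂π :=
  iInf_le_of_le π (iInf_le_of_le h₁ (iInf_le_of_le h₂ le_rfl))

lemma supProb_le_of_forall {A : Set (Ed d)} {c : ℝ} (hc : 0 ≤ c)
    (h : ∀ Q : Measure (Ed d), IsProbabilityMeasure Q →
      wassersteinDist Q P ≤ ENNReal.ofReal δ → Q.real A ≤ c) : supProb δ P A ≤ c := by
  refine Real.sSup_le ?_ hc
  rintro v ⟨Q, hQ, hW, rfl⟩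
  exact h Q hQ hW

lemma le_supProb {A : Set (Ed d)} {Q : Measure (Ed d)} [IsProbabilityMeasure Q]
    (h : wassersteinDist Q P ≤ ENNReal.ofReal δ) : Q.real A ≤ supProb δ P A := by
  refine le_csSup ⟨1, ?_⟩ ⟨Q, inferInstance, h, rfl⟩
  rintro v ⟨Q, hQ, -, rfl⟩
  exact measureReal_le_one

lemma supProb_nonneg {A : Set (Ed d)} : 0 ≤ supProb δ P A := by
  refine Real.sSup_nonneg ?_
  rintro v ⟨Q, -, -, rfl⟩
  exact ENNReal.toReal_nonneg

lemma supProb_le_one {A : Set (Ed d)} : supProb δ P A ≤ 1 :=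
  supProb_le_of_forall zero_le_one fun _ _ _ ↦ measureReal_le_one

lemma real_univ_le_supProb [IsProbabilityMeasure P] (hu : ‖u‖ = 1) {ν : Measure (Ed d)}
    (hν : ν ≤ P) (hcost : halfspaceCost u z ν ≤ ENNReal.ofReal δ) :
    ν.real Set.univ ≤ supProb δ P {x | 0 ≤ ⟪u, x - z⟫} := by
  have : IsFiniteMeasure ν := isFiniteMeasure_of_le P hν
  have hsub : P - ν + ν = P := Measure.sub_add_cancel_of_le hν
  set f : Ed d → Ed d := fun x ↦ x + max 0 ⟪u, z - x⟫ • u with hf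
  have hfm : Measurable f := by fun_prop
  have hfdist : ∀ x, ENNReal.ofReal ‖f x - x‖ = ENNReal.ofReal ⟪u, z - x⟫ := by
    intro x
    simp only [hf, add_sub_cancel_left, norm_smul, hu, mul_one, Real.norm_eq_abs]
    rw [abs_of_nonneg (le_max_left _ _), max_comm, ENNReal.ofReal_max]
    simp
  have hfmem : ∀ x, 0 ≤ ⟪u, f x - z⟫ := by
    intro x
    have : ⟪u, f x - z⟫ = max 0 ⟪u, z - x⟫ - ⟪u, z - x⟫ := by
      simp only [hf, inner_sub_right, inner_add_right, inner_smul_right,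
        real_inner_self_eq_norm_sq, hu]
      ring
    rw [this]
    exact sub_nonneg.2 (le_max_right _ _)
  set π : Measure (Ed d × Ed d) :=
    ν.map (fun x ↦ (f x, x)) + (P - ν).map (fun x ↦ (x, x)) with hπ
  have h₁ : π.map Prod.fst = ν.map f + (P - ν) := by
    rw [hπ, Measure.map_add _ _ measurable_fst, Measure.map_map measurable_fst (by fun_prop),
      Measure.map_map measurable_fst (by fun_prop)]
    congr 1
    exact Measure.map_id
  have h₂ : π.map Prod.snd = P := by
    rw [hπ, Measure.map_add _ _ measurable_snd, Measure.map_map measurable_snd (by fun_prop),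
      Measure.map_map measurable_snd (by fun_prop)]
    refine Eq.trans ?_ hsub
    rw [add_comm]
    congr 1 <;> exact Measure.map_id
  have hprob : IsProbabilityMeasure (ν.map f + (P - ν)) := by
    constructor
    rw [Measure.add_apply, Measure.map_apply hfm .univ, Set.preimage_univ, add_comm,
      ← Measure.add_apply, hsub, measure_univ]
  have hW : wassersteinDist (ν.map f + (P - ν)) P ≤ ENNReal.ofReal δ := by
    refine (wassersteinDist_le h₁ h₂).trans ?_
    rw [hπ, lintegral_add_measure, lintegral_map (by fun_prop) (by fun_prop),
      lintegral_map (by fun_prop) (by fun_prop)]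
    simpa [hfdist, halfspaceCost] using hcost
  refine le_trans ?_ (le_supProb hW)
  have hmeas : MeasurableSet {x : Ed d | 0 ≤ ⟪u, x - z⟫} :=
    measurableSet_le measurable_const (by fun_prop)
  refine ENNReal.toReal_mono (measure_ne_top _ _) ?_
  rw [Measure.add_apply, Measure.map_apply hfm hmeas]
  have : f ⁻¹' {x | 0 ≤ ⟪u, x - z⟫} = Set.univ := Set.eq_univ_of_forall hfmem
  rw [this]
  exact le_self_add

lemma exists_le_of_wassersteinDist_lt (hu : ‖u‖ = 1) {Q : Measure (Ed d)} {r : ℝ≥0∞}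
    (hW : wassersteinDist Q P < r) :
    ∃ ν ≤ P, halfspaceCost u z ν ≤ r ∧ ν Set.univ = Q {x | 0 ≤ ⟪u, x - z⟫} := by
  simp only [wassersteinDist, iInf_lt_iff] at hW
  obtain ⟨π, h₁, h₂, hπ⟩ := hW
  have hmeas : MeasurableSet {x : Ed d | 0 ≤ ⟪u, x - z⟫} :=
    measurableSet_le measurable_const (by fun_prop)
  set B : Set (Ed d × Ed d) := Prod.fst ⁻¹' {x | 0 ≤ ⟪u, x - z⟫} with hB
  have hBm : MeasurableSet B := measurable_fst hmeas
  refine ⟨(π.restrict B).map Prod.snd, ?_, ?_, ?_⟩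
  · rw [← h₂]
    exact Measure.map_mono Measure.restrict_le_self measurable_snd
  · rw [halfspaceCost, lintegral_map (by fun_prop) measurable_snd]
    refine le_trans ?_ hπ.le
    refine le_trans (setLIntegral_mono' hBm fun p hp ↦ ?_) (setLIntegral_le_lintegral B _)
    refine ENNReal.ofReal_le_ofReal ?_
    have hp : 0 ≤ ⟪u, p.1 - z⟫ := hp
    have h := real_inner_le_norm u (p.1 - p.2)
    rw [hu, one_mul] at h
    simp only [inner_sub_right] at hp h ⊢
    linarith
  · rw [Measure.map_apply measurable_snd .univ, Set.preimage_univ, Measure.restrict_apply_univ,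
      hB, ← Measure.map_apply measurable_fst hmeas, h₁]

lemma convexComb_le_supProb [IsProbabilityMeasure P] (hu : ‖u‖ = 1) {ν ρ : Measure (Ed d)}
    (hν : ν ≤ P) (hρ : ρ ≤ P) {a b τ : ℝ} (ha : 0 ≤ a) (hb : 0 ≤ b)
    (hνa : halfspaceCost u z ν ≤ ENNReal.ofReal a) (hρb : halfspaceCost u z ρ ≤ ENNReal.ofReal b)
    (hτ₀ : 0 ≤ τ) (hτ₁ : τ ≤ 1) (hab : (1 - τ) * a + τ * b ≤ δ) :
    (1 - τ) * ν.real Set.univ + τ * ρ.real Set.univ ≤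
      supProb δ P {x | 0 ≤ ⟪u, x - z⟫} := by
  have : IsFiniteMeasure ν := isFiniteMeasure_of_le P hν
  have : IsFiniteMeasure ρ := isFiniteMeasure_of_le P hρ
  have h1τ : 0 ≤ 1 - τ := sub_nonneg.2 hτ₁
  have hle : ENNReal.ofReal (1 - τ) • ν + ENNReal.ofReal τ • ρ ≤ P := by
    calc _ ≤ ENNReal.ofReal (1 - τ) • P + ENNReal.ofReal τ • P := by
          gcongr
      _ = P := by
          rw [← add_smul, ← ENNReal.ofReal_add h1τ hτ₀]
          simp
  have hcost : halfspaceCost u z (ENNReal.ofReal (1 - τ) • ν + ENNReal.ofReal τ • ρ) ≤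
      ENNReal.ofReal δ := by
    rw [halfspaceCost, lintegral_add_measure, lintegral_smul_measure, lintegral_smul_measure]
    refine le_trans ?_ (ENNReal.ofReal_le_ofReal hab)
    rw [ENNReal.ofReal_add (by positivity) (by positivity), ENNReal.ofReal_mul h1τ,
      ENNReal.ofReal_mul hτ₀, smul_eq_mul, smul_eq_mul]
    gcongr
    · exact hνa
    · exact hρb
  refine le_of_eq_of_le ?_ (real_univ_le_supProb hu hle hcost)
  simp only [measureReal_def, Measure.add_apply, Measure.smul_apply, smul_eq_mul]
  rw [ENNReal.toReal_add (by finiteness) (by finiteness), ENNReal.toReal_mul, ENNReal.toReal_mul,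
    ENNReal.toReal_ofReal h1τ, ENNReal.toReal_ofReal hτ₀]

lemma mul_real_univ_le_supProb [IsProbabilityMeasure P] (hδ : 0 < δ) (hu : ‖u‖ = 1)
    {ν : Measure (Ed d)} (hν : ν ≤ P) {h : ℝ} (hh : 0 ≤ h)
    (hcost : halfspaceCost u z ν ≤ ENNReal.ofReal (δ + h)) :
    ν.real Set.univ ≤ (1 + h / δ) * supProb δ P {x | 0 ≤ ⟪u, x - z⟫} := by
  have hpos : 0 < δ + h := by positivity
  have hmix := convexComb_le_supProb (δ := δ) (τ := h / (δ + h)) hu hν (Measure.zero_le P)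
    hpos.le le_rfl hcost (by simp [halfspaceCost]) (by positivity)
    (div_le_one_of_le₀ (by linarith) hpos.le) (by field_simp; linarith)
  have h1 : 1 - h / (δ + h) = δ / (δ + h) := by field_simp; ring
  have h2 : 1 + h / δ = (δ + h) / δ := by field_simp
  rw [measureReal_zero_apply, mul_zero, add_zero, h1] at hmix
  calc ν.real Set.univ = (δ + h) / δ * (δ / (δ + h) * ν.real Set.univ) := by field_simp
    _ ≤ _ := by rw [h2]; gcongr

lemma supProb_le_of_forall_le [IsProbabilityMeasure P] (hδ : 0 < δ) (hu : ‖u‖ = 1) {c : ℝ}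
    (h : ∀ ν ≤ P, halfspaceCost u z ν ≤ ENNReal.ofReal δ → ν.real Set.univ ≤ c) :
    supProb δ P {x | 0 ≤ ⟪u, x - z⟫} ≤ c := by
  have hc : 0 ≤ c := by simpa using h 0 (Measure.zero_le P) (by simp [halfspaceCost])
  refine supProb_le_of_forall hc fun Q hQ hW ↦ le_of_forall_pos_le_add fun η hη ↦ ?_
  set κ := δ / (c + 1) * η with hκ
  have hκ₀ : 0 < κ := by positivity
  obtain ⟨ν, hν, hcost, hmass⟩ := exists_le_of_wassersteinDist_lt (z := z) hu
    (hW.trans_lt ((ENNReal.ofReal_lt_ofReal_iff (by positivity)).2 (by linarith : δ < δ + κ)))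
  have : IsFiniteMeasure ν := isFiniteMeasure_of_le P hν
  have hscale : ENNReal.ofReal (δ / (δ + κ)) • ν ≤ P := by
    refine le_trans ?_ hν
    intro s
    rw [Measure.smul_apply, smul_eq_mul]
    refine mul_le_of_le_one_left' (ENNReal.ofReal_le_one.2 ?_)
    exact div_le_one_of_le₀ (by linarith) (by positivity)
  have hm := h _ hscale (by
    rw [halfspaceCost, lintegral_smul_measure, smul_eq_mul]
    calc _ ≤ ENNReal.ofReal (δ / (δ + κ)) * ENNReal.ofReal (δ + κ) := by gcongr; exact hcost
      _ = ENNReal.ofReal δ := by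
        rw [← ENNReal.ofReal_mul (by positivity)]
        congr 1
        field_simp)
  have hQν : Q.real {x | 0 ≤ ⟪u, x - z⟫} = ν.real Set.univ := by
    rw [measureReal_def, measureReal_def, hmass]
  rw [hQν]
  rw [measureReal_def, Measure.smul_apply, smul_eq_mul, ENNReal.toReal_mul,
    ENNReal.toReal_ofReal (by positivity), ← measureReal_def, div_mul_eq_mul_div,
    div_le_iff₀ (by positivity)] at hm
  have hcκ : c * κ ≤ δ * η := by
    rw [hκ, show c * (δ / (c + 1) * η) = δ * η * (c / (c + 1)) by field_simp]
    exact mul_le_of_le_one_right (by positivity) (div_le_one_of_le₀ (by linarith) (by positivity))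
  exact le_of_mul_le_mul_left (by nlinarith) hδ

lemma halfspaceCost_le_add [IsProbabilityMeasure P] (hδ : 0 ≤ δ) (hu : ‖u‖ = 1) {z' : Ed d}
    {ν : Measure (Ed d)} (hν : ν ≤ P) (hcost : halfspaceCost u z ν ≤ ENNReal.ofReal δ) :
    halfspaceCost u z' ν ≤ ENNReal.ofReal (δ + dist z z') := by
  calc halfspaceCost u z' ν
      ≤ ∫⁻ x, (ENNReal.ofReal ⟪u, z - x⟫ + ENNReal.ofReal (dist z z')) ∂ν := by
        refine lintegral_mono fun x ↦ ?_
        refine le_trans (ENNReal.ofReal_le_ofReal ?_) ENNReal.ofReal_add_le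
        have h := real_inner_le_norm u (z' - z)
        rw [hu, one_mul, ← dist_eq_norm, dist_comm] at h
        simp only [inner_sub_right] at h ⊢
        linarith
    _ = halfspaceCost u z ν + ENNReal.ofReal (dist z z') * ν Set.univ := by
        rw [lintegral_add_right _ measurable_const, lintegral_const, halfspaceCost]
    _ ≤ ENNReal.ofReal δ + ENNReal.ofReal (dist z z') * 1 := by
        gcongr
        exact (hν Set.univ).trans prob_le_one
    _ = ENNReal.ofReal (δ + dist z z') := by
        rw [mul_one, ENNReal.ofReal_add hδ dist_nonneg]

lemma robustDepth_le_supProb (hu : ‖u‖ = 1) :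
    robustDepth δ z P ≤ supProb δ P {x | 0 ≤ ⟪u, x - z⟫} := by
  refine csInf_le ⟨0, ?_⟩ ⟨u, hu, rfl⟩
  rintro v ⟨u, -, rfl⟩
  exact supProb_nonneg

lemma le_robustDepth (hd : ∃ u : Ed d, ‖u‖ = 1) {c : ℝ}
    (h : ∀ u : Ed d, ‖u‖ = 1 → c ≤ supProb δ P {x | 0 ≤ ⟪u, x - z⟫}) :
    c ≤ robustDepth δ z P := by
  obtain ⟨u₀, hu₀⟩ := hd
  refine le_csInf ⟨_, u₀, hu₀, rfl⟩ ?_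
  rintro v ⟨u, hu, rfl⟩
  exact h u hu

lemma robustDepth_le_add_dist [IsProbabilityMeasure P] (hδ : 0 < δ)
    (hd : ∃ u : Ed d, ‖u‖ = 1) (z z' : Ed d) :
    robustDepth δ z P ≤ robustDepth δ z' P + δ⁻¹ * dist z z' := by
  rw [← sub_le_iff_le_add]
  refine le_robustDepth hd fun u hu ↦ ?_
  have h : supProb δ P {x | 0 ≤ ⟪u, x - z⟫} ≤
      (1 + dist z z' / δ) * supProb δ P {x | 0 ≤ ⟪u, x - z'⟫} :=
    supProb_le_of_forall_le hδ hu fun ν hν hcost ↦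
      mul_real_univ_le_supProb hδ hu hν dist_nonneg (halfspaceCost_le_add hδ.le hu hν hcost)
  have h₁ : dist z z' / δ * supProb δ P {x | 0 ≤ ⟪u, x - z'⟫} ≤ dist z z' / δ :=
    mul_le_of_le_one_right (by positivity) supProb_le_one
  have h₂ : δ⁻¹ * dist z z' = dist z z' / δ := by ring
  linarith [robustDepth_le_supProb (δ := δ) (P := P) (z := z) hu]

lemma continuous_robustDepth [IsProbabilityMeasure P] (hδ : 0 < δ)
    (hd : ∃ u : Ed d, ‖u‖ = 1) : Continuous fun z ↦ robustDepth δ z P :=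
  (LipschitzWith.of_le_add_mul (Real.toNNReal δ⁻¹) fun z z' ↦ by
    rw [Real.coe_toNNReal _ (by positivity)]
    exact robustDepth_le_add_dist hδ hd z z').continuous

lemma exists_lt_measureReal_closedBall [IsProbabilityMeasure P] (z : Ed d) {γ : ℝ} (hγ : γ < 1) :
    ∃ R > 0, γ < P.real (Metric.closedBall z R) := by
  have h : Filter.Tendsto (fun n : ℕ ↦ P (Metric.closedBall z (n : ℝ))) Filter.atTop
      (nhds (P (⋃ n : ℕ, Metric.closedBall z (n : ℝ)))) :=
    tendsto_measure_iUnion_atTop fun m n hmn ↦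
      Metric.closedBall_subset_closedBall (by exact_mod_cast hmn)
  rw [Metric.iUnion_closedBall_nat, measure_univ] at h
  have h' := (ENNReal.tendsto_toReal ENNReal.one_ne_top).comp h
  rw [ENNReal.toReal_one] at h'
  obtain ⟨n, hn, hn₀⟩ := ((h'.eventually_const_lt hγ).and (Filter.eventually_gt_atTop 0)).exists
  exact ⟨n, by exact_mod_cast hn₀, hn⟩

lemma halfspaceCost_restrict_closedBall_le [IsProbabilityMeasure P] (hu : ‖u‖ = 1) (R : ℝ) :
    halfspaceCost u z (P.restrict (Metric.closedBall z R)) ≤ ENNReal.ofReal R := by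
  calc _ ≤ ∫⁻ _ in Metric.closedBall z R, ENNReal.ofReal R ∂P := by
        refine setLIntegral_mono' Metric.isClosed_closedBall.measurableSet fun x hx ↦ ?_
        refine ENNReal.ofReal_le_ofReal ?_
        have h := real_inner_le_norm u (z - x)
        rw [hu, one_mul, ← dist_eq_norm, dist_comm] at h
        exact h.trans hx
    _ ≤ _ := by
        rw [setLIntegral_const]
        exact mul_le_of_le_one_right' prob_le_one

lemma halfspaceCost_add_mul_measure_le (hu : ‖u‖ = 1) {ε : ℝ} (hε : 0 ≤ ε)
    (ν : Measure (Ed d)) :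
    halfspaceCost u z ν + ENNReal.ofReal ε * ν {x | 0 < ⟪u, z - x⟫} ≤
      halfspaceCost u (z + ε • u) ν := by
  have hmeas : MeasurableSet {x : Ed d | 0 < ⟪u, z - x⟫} :=
    measurableSet_lt measurable_const (by fun_prop)
  rw [halfspaceCost, ← lintegral_indicator_const hmeas, ← lintegral_add_left (by fun_prop)]
  refine lintegral_mono fun x ↦ ?_
  have hx : ⟪u, z + ε • u - x⟫ = ⟪u, z - x⟫ + ε := by
    simp only [inner_sub_right, inner_add_right, inner_smul_right, real_inner_self_eq_norm_sq, hu]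
    ring
  dsimp only
  rw [hx]
  by_cases h : 0 < ⟪u, z - x⟫
  · rw [Set.indicator_of_mem (show x ∈ {x | 0 < ⟪u, z - x⟫} from h), ENNReal.ofReal_add h.le hε]
  · rw [Set.indicator_of_notMem (show x ∉ {x | 0 < ⟪u, z - x⟫} from h), add_zero]
    exact ENNReal.ofReal_le_ofReal (by linarith)

/-- Moving `z` in direction `u` decreases the worst-case halfspace probability by an amount that
does not depend on `u`, as long as this probability stays away from one. -/
lemma exists_supProb_add_le [IsProbabilityMeasure P] (hδ : 0 < δ) (z : Ed d) {β ε : ℝ}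
    (hβ : β < 1) (hε : 0 < ε) :
    ∃ c > 0, ∀ u : Ed d, ‖u‖ = 1 → supProb δ P {x | 0 ≤ ⟪u, x - z⟫} ≤ β →
      supProb δ P {x | 0 ≤ ⟪u, x - (z + ε • u)⟫} + c ≤ supProb δ P {x | 0 ≤ ⟪u, x - z⟫} := by
  obtain ⟨γ, hβγ, hγ⟩ := exists_between hβ
  obtain ⟨R, hR, hRγ⟩ := exists_lt_measureReal_closedBall (P := P) z hγ
  obtain ⟨g, hg, rfl⟩ : ∃ g > 0, γ = β + g := ⟨γ - β, by linarith, by ring⟩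
  set τ₀ := min 1 (δ / R) with hτ₀
  have hτ₀pos : 0 < τ₀ := by positivity
  have hτ₀R : τ₀ * R ≤ δ := (le_div_iff₀ hR).1 (min_le_right _ _)
  set q₀ := τ₀ * g / 2 with hq₀
  have hq₀pos : 0 < q₀ := by positivity
  set τ₁ := min 1 (ε * q₀ / R) with hτ₁
  have hτ₁pos : 0 < τ₁ := by positivity
  have hτ₁R : τ₁ * R ≤ ε * q₀ := (le_div_iff₀ hR).1 (min_le_right _ _)
  refine ⟨min (τ₁ * g) q₀, by positivity, fun u hu hS ↦ ?_⟩
  set S := supProb δ P {x | 0 ≤ ⟪u, x - z⟫}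
  have hball := halfspaceCost_restrict_closedBall_le (P := P) (z := z) hu R
  set ρ := P.restrict (Metric.closedBall z R) with hρ
  have hρP : ρ ≤ P := Measure.restrict_le_self
  have hρm : ρ.real Set.univ = P.real (Metric.closedBall z R) := by
    rw [hρ, measureReal_restrict_apply_univ]
  rw [← le_sub_iff_add_le]
  refine supProb_le_of_forall_le hδ hu fun ν hν hcost ↦ ?_
  have : IsFiniteMeasure ν := isFiniteMeasure_of_le P hν
  have hsave := (halfspaceCost_add_mul_measure_le hu hε.le ν (z := z)).trans hcost
  set q := ν.real {x | 0 < ⟪u, z - x⟫} with hq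
  have hmeas : MeasurableSet {x : Ed d | 0 < ⟪u, z - x⟫} :=
    measurableSet_lt measurable_const (by fun_prop)
  have hq_nonneg : 0 ≤ q := measureReal_nonneg
  have hmul : ENNReal.ofReal ε * ν {x | 0 < ⟪u, z - x⟫} = ENNReal.ofReal (ε * q) := by
    rw [ENNReal.ofReal_mul hε.le, hq, ofReal_measureReal]
  rw [hmul] at hsave
  have hεq : ε * q ≤ δ := (ENNReal.ofReal_le_ofReal_iff hδ.le).1 (le_add_self.trans hsave)
  have hνz : halfspaceCost u z ν ≤ ENNReal.ofReal (δ - ε * q) := by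
    rw [ENNReal.ofReal_sub _ (by positivity)]
    exact ENNReal.le_sub_of_add_le_right ENNReal.ofReal_ne_top hsave
  have hmS : ν.real Set.univ ≤ S :=
    real_univ_le_supProb hu hν (hνz.trans (ENNReal.ofReal_le_ofReal (by nlinarith)))
  rcases le_or_gt q₀ q with hqq | hqq
  · have h1 : 0 ≤ 1 - τ₁ := sub_nonneg.2 (min_le_left _ _)
    have hmix := convexComb_le_supProb (δ := δ) (τ := τ₁) hu hν hρP (sub_nonneg.2 hεq) hR.le
      hνz hball hτ₁pos.le (min_le_left _ _) (by nlinarith)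
    rw [hρm] at hmix
    have hmin := min_le_left (τ₁ * g) q₀
    nlinarith
  · set A : Set (Ed d) := {x | 0 < ⟪u, z - x⟫}ᶜ
    have hA : halfspaceCost u z (ν.restrict A) ≤ ENNReal.ofReal 0 := by
      rw [halfspaceCost, setLIntegral_congr_fun (g := fun _ ↦ 0) hmeas.compl
        fun x hx ↦ ENNReal.ofReal_of_nonpos (not_lt.1 hx)]
      simp
    have hmix := convexComb_le_supProb (δ := δ) (τ := τ₀) hu
      (Measure.restrict_le_self.trans hν) hρP le_rfl hR.le hA hball hτ₀pos.le (min_le_left _ _)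
      (by linarith)
    rw [hρm, measureReal_restrict_apply_univ, measureReal_compl hmeas] at hmix
    have hmin := min_le_right (τ₁ * g) q₀
    nlinarith

lemma exists_robustDepth_lt [IsProbabilityMeasure P] (hδ : 0 < δ) (hd : ∃ u : Ed d, ‖u‖ = 1)
    (hz : robustDepth δ z P < 1) {ε : ℝ} (hε : 0 < ε) :
    ∃ z', dist z z' ≤ ε ∧ robustDepth δ z' P < robustDepth δ z P := by
  obtain ⟨β, hαβ, hβ⟩ := exists_between hz
  obtain ⟨c, hc, hdec⟩ := exists_supProb_add_le (P := P) hδ z hβ hε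
  obtain ⟨u, hu, hlt⟩ : ∃ u : Ed d, ‖u‖ = 1 ∧
      supProb δ P {x | 0 ≤ ⟪u, x - z⟫} < min β (robustDepth δ z P + c) := by
    by_contra! h
    exact (le_robustDepth hd h).not_gt (lt_min hαβ (by linarith))
  refine ⟨z + ε • u, by simp [norm_smul, hu, abs_of_pos hε], ?_⟩
  have h₁ := hdec u hu (hlt.trans_le (min_le_left _ _)).le
  have h₂ := hlt.trans_le (min_le_right _ _)
  linarith [robustDepth_le_supProb (δ := δ) (P := P) (z := z + ε • u) hu]

end

/-- **Level sets (P6).** For `α ∈ (0,1)` the exact level set `{z : D_δ(z|P) = α}` is the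
topological boundary of the upper level set `{z : D_δ(z|P) ≥ α}`, or both sets are empty. -/
theorem robustDepth_levelSet_eq_frontier {d : ℕ} (δ : ℝ) (hδ : 0 < δ)
    (P : Measure (Ed d)) [IsProbabilityMeasure P] (α : ℝ) (hα : α ∈ Set.Ioo (0:ℝ) 1) :
    {z : Ed d | robustDepth δ z P = α} = frontier {z : Ed d | α ≤ robustDepth δ z P} ∨
    ({z : Ed d | robustDepth δ z P = α} = ∅ ∧ {z : Ed d | α ≤ robustDepth δ z P} = ∅) := by
  by_cases hd : ∃ u : Ed d, ‖u‖ = 1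
  · left
    have hcont := continuous_robustDepth (P := P) hδ hd
    refine Set.Subset.antisymm (fun z hz ↦ ?_)
      ((frontier_le_subset_eq continuous_const hcont).trans fun z hz ↦ Eq.symm hz)
    have hz : robustDepth δ z P = α := hz
    rw [(isClosed_le continuous_const hcont).frontier_eq, Set.mem_sdiff]
    refine ⟨hz.ge, fun hint ↦ ?_⟩
    obtain ⟨r, hr, hball⟩ := Metric.mem_nhds_iff.1 (mem_interior_iff_mem_nhds.1 hint)
    obtain ⟨z', hdist, hlt⟩ := exists_robustDepth_lt hδ hd (hz.trans_lt hα.2) (half_pos hr)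
    have hmem : α ≤ robustDepth δ z' P :=
      hball (Metric.mem_ball'.2 (hdist.trans_lt (half_lt_self hr)))
    linarith
  · right
    have hzero : ∀ z, robustDepth δ z P = 0 := by
      intro z
      have hempty : {v : ℝ | ∃ u : Ed d, ‖u‖ = 1 ∧ v = supProb δ P {x | 0 ≤ ⟪u, x - z⟫}} = ∅ :=
        Set.eq_empty_of_forall_notMem fun v ⟨u, hu, _⟩ ↦ hd ⟨u, hu⟩
      rw [robustDepth, hempty, Real.sInf_empty]
    simp [hzero, hα.1.ne, hα.1.not_ge]
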